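/- Let v = (a, b, c) ∈ ℝ³ with a² + b² = c² and c > 0. Then the third coordinate of H·v, namely −2a − 2b + 3c, is also positive. In other words, the reflection H leaves stable the set C_Q⁺ = {(a,b,c) : a² + b² − c² = 0, c > 0}. -/

import Mathlib

/-- The reflection H = s_{(1,1,1)}. -/
def Hmat : Matrix (Fin 3) (Fin 3) ℝ := !![-1, -2, 2; -2, -1, 2; -2, -2, 3]

theorem stmt_3 (a b c : ℝ) (h : a ^ 2 + b ^ 2 = c ^ 2) (hc : 0 < c) :
    Hmat.mulVec ![a, b, c] 2 = -2 * a - 2 * b + 3 * c ∧ 0 < -2 * a - 2 * b + 3 * c := by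
  refine ⟨?_, ?_⟩
  · simp [Hmat, Matrix.mulVec, dotProduct, Fin.sum_univ_three]
    ring
  · have hlt : 2 * (a + b) < 3 * c :=
      lt_of_pow_lt_pow_left₀ 2 (by positivity) (by nlinarith [sq_nonneg (a - b), pow_pos hc 2])
    linarith
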